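/- For every admissible substitution σ_v, every refutation of Ω_n in IR-calc^{σ_v} has size superpolynomial in n: for every polynomial q, for all sufficiently large n, every IR-calc^{σ_v} refutation of Ω_n (for any σ_v mapping universal variables of Ω_n to existential variables of strictly smaller level) has size greater than q(n). (In Ω_n the universal block is the first block, so every admissible σ_v is empty and the claim reduces to the IR-calc lower bound.) -/

import Mathlib

/-! ## Propositional / QBF side -/

inductive Lit where
  | pos (x : ℕ)
  | neg (x : ℕ)
deriving DecidableEq

def Lit.var : Lit → ℕ
  | pos x => x
  | neg x => x

def Lit.isPos : Lit → Bool
  | pos _ => true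
  | neg _ => false

def Lit.negate : Lit → Lit
  | pos x => neg x
  | neg x => pos x

def Lit.eval (v : ℕ → Bool) : Lit → Bool
  | pos x => v x
  | neg x => !(v x)

abbrev Clause := Finset Lit

def Clause.Taut (C : Clause) : Prop := ∃ x, Lit.pos x ∈ C ∧ Lit.neg x ∈ C

/-- A prenex CNF: a list of quantifier blocks (`true` = existential,
`false` = universal), each with an ordered list of variables, and a matrix
which is a finite set of clauses. -/
structure PCNF where
  blocks : List (Bool × List ℕ)
  matrix : Finset Clause

def PCNF.allVars (Φ : PCNF) : List ℕ := Φ.blocks.flatMap (·.2)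

/-- Well-formedness: quantifier blocks alternate and the blocks are
pairwise disjoint sets of variables (no repetitions). -/
def PCNF.WF (Φ : PCNF) : Prop :=
  List.Chain' (fun a b => a.1 ≠ b.1) Φ.blocks ∧ Φ.allVars.Nodup ∧
    ∀ b ∈ Φ.blocks, b.2 ≠ []

/-- Closedness: every variable of the matrix is quantified in the prefix. -/
def PCNF.Closed (Φ : PCNF) : Prop :=
  ∀ C ∈ Φ.matrix, ∀ l ∈ C, l.var ∈ Φ.allVars

def PCNF.existB (Φ : PCNF) (x : ℕ) : Bool :=
  Φ.blocks.any fun b => b.1 && b.2.contains x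

def PCNF.univB (Φ : PCNF) (x : ℕ) : Bool :=
  Φ.blocks.any fun b => !b.1 && b.2.contains x

/-- The level of a variable: the index of its quantifier block. -/
def PCNF.lv (Φ : PCNF) (x : ℕ) : ℕ :=
  Φ.blocks.findIdx fun b => b.2.contains x

def evalClause (v : ℕ → Bool) (C : Clause) : Prop := ∃ l ∈ C, l.eval v = true

/-- Standard QBF semantics of a prenex CNF, evaluated block by block. -/
def truthAux (M : Finset Clause) : List (Bool × List ℕ) → (ℕ → Bool) → Prop
  | [], v => ∀ C ∈ M, evalClause v C
  | (q, xs) :: rest, v =>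
      if q then ∃ w : ℕ → Bool, (∀ y, y ∉ xs → w y = v y) ∧ truthAux M rest w
      else ∀ w : ℕ → Bool, (∀ y, y ∉ xs → w y = v y) → truthAux M rest w

def PCNF.IsTrue (Φ : PCNF) : Prop := truthAux Φ.matrix Φ.blocks fun _ => false

/-! ## Q-resolution and QU-resolution -/

/-- One derivation step of Q-res (`univPivot = false`) resp. QU-res
(`univPivot = true`) from the clauses derived so far. -/
inductive QStep (Φ : PCNF) (univPivot : Bool) (prev : List Clause) : Clause → Prop
  | ax (C : Clause) (hC : C ∈ Φ.matrix) (hnt : ¬ C.Taut) : QStep Φ univPivot prev C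
  | res (x : ℕ) (A B : Clause) (hA : A ∈ prev) (hB : B ∈ prev)
      (hxa : Lit.pos x ∈ A) (hxb : Lit.neg x ∈ B)
      (hpiv : Φ.existB x = true ∨ (univPivot = true ∧ Φ.univB x = true))
      (hblock : ∀ l ∈ A.erase (Lit.pos x), l.negate ∉ B.erase (Lit.neg x)) :
      QStep Φ univPivot prev ((A.erase (Lit.pos x)) ∪ (B.erase (Lit.neg x)))
  | fac (A : Clause) (hA : A ∈ prev) : QStep Φ univPivot prev A
  | univRed (A : Clause) (m : Lit) (hA : A ∈ prev) (hm : m ∈ A)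
      (hu : Φ.univB m.var = true)
      (hlv : ∀ l ∈ A.erase m, Φ.existB l.var = true → Φ.lv l.var < Φ.lv m.var) :
      QStep Φ univPivot prev (A.erase m)

def QValid (Φ : PCNF) (univPivot : Bool) (π : List Clause) : Prop :=
  ∀ i < π.length, QStep Φ univPivot (π.take i) π[i]!

def QRefutation (Φ : PCNF) (univPivot : Bool) (π : List Clause) : Prop :=
  QValid Φ univPivot π ∧ π ≠ [] ∧ π.getLast! = (∅ : Clause)

/-- Size of a (QBF) resolution derivation: total number of literal
occurrences in its clauses. -/
def qSize (π : List Clause) : ℕ := (π.map Finset.card).sum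

/-! ## First-order terms, atoms, literals, clauses -/

inductive FTerm where
  | var (x : ℕ)
  | app (f : ℕ) (args : List FTerm)

noncomputable instance : DecidableEq FTerm := Classical.decEq _

def FTerm.subst (σ : ℕ → FTerm) : FTerm → FTerm
  | .var x => σ x
  | .app f args => .app f (args.attach.map fun t => t.1.subst σ)
decreasing_by
  have := List.sizeOf_lt_of_mem t.2
  simp only [FTerm.app.sizeOf_spec]; omega

def FTerm.symSize : FTerm → ℕ
  | .var _ => 1
  | .app _ args => 1 + (args.attach.map fun t => t.1.symSize).sum
decreasing_by
  have := List.sizeOf_lt_of_mem t.2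
  simp only [FTerm.app.sizeOf_spec]; omega

def FTerm.vars : FTerm → Finset ℕ
  | .var x => {x}
  | .app _ args => (args.attach.map fun t => t.1.vars).foldr (· ∪ ·) ∅
decreasing_by
  have := List.sizeOf_lt_of_mem t.2
  simp only [FTerm.app.sizeOf_spec]; omega

/-- An atom `p(t₁,…,t_k)`: predicate symbol together with argument list. -/
structure FAtom where
  p : ℕ
  args : List FTerm

noncomputable instance : DecidableEq FAtom := Classical.decEq _

def FAtom.subst (σ : ℕ → FTerm) (a : FAtom) : FAtom := ⟨a.p, a.args.map (FTerm.subst σ)⟩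
def FAtom.symSize (a : FAtom) : ℕ := 1 + (a.args.map FTerm.symSize).sum
def FAtom.vars (a : FAtom) : Finset ℕ := (a.args.map FTerm.vars).foldr (· ∪ ·) ∅

inductive FLit where
  | pos (a : FAtom)
  | neg (a : FAtom)

noncomputable instance : DecidableEq FLit := Classical.decEq _

def FLit.atom : FLit → FAtom
  | pos a => a
  | neg a => a

def FLit.isPos : FLit → Bool
  | pos _ => true
  | neg _ => false

def FLit.subst (σ : ℕ → FTerm) : FLit → FLit
  | pos a => pos (a.subst σ)
  | neg a => neg (a.subst σ)

def FLit.symSize (l : FLit) : ℕ :=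
  match l with
  | .pos a => a.symSize
  | .neg a => 1 + a.symSize

abbrev FClause := Finset FLit

noncomputable def FClause.subst (σ : ℕ → FTerm) (C : FClause) : FClause :=
  C.image (FLit.subst σ)

noncomputable def FClause.symSize (C : FClause) : ℕ := ∑ l ∈ C, l.symSize

noncomputable def FClause.fvars (C : FClause) : Finset ℕ := C.sup fun l => l.atom.vars

/-! ## First-order resolution R1 -/

def compSub (σ μ : ℕ → FTerm) : ℕ → FTerm := fun x => (σ x).subst μ

def Unifies (σ : ℕ → FTerm) (a b : FAtom) : Prop := a.subst σ = b.subst σ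

def IsMGU (σ : ℕ → FTerm) (a b : FAtom) : Prop :=
  Unifies σ a b ∧ ∀ τ, Unifies τ a b → ∃ μ, ∀ x, compSub σ μ x = τ x

/-- `D` is a factor of `C`: `D = Cσ` for `σ` an mgu of two distinct
same-sign literals of `C`. -/
def IsFactor (C D : FClause) : Prop :=
  ∃ K L σ, K ∈ C ∧ L ∈ C ∧ K ≠ L ∧ K.isPos = L.isPos ∧
    IsMGU σ K.atom L.atom ∧ D = C.subst σ

def renameSub (ρ : ℕ → ℕ) : ℕ → FTerm := fun x => .var (ρ x)

/-- `E` is a resolvent of `C` and `D`. -/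
def IsResolvent (C D E : FClause) : Prop :=
  ∃ ρ : ℕ → ℕ, Function.Injective ρ ∧
    ∃ K L σ, Disjoint C.fvars (FClause.subst (renameSub ρ) D).fvars ∧
      K ∈ C ∧ L ∈ FClause.subst (renameSub ρ) D ∧ K.isPos = !L.isPos ∧
      IsMGU σ K.atom L.atom ∧
      E = ((C.subst σ).erase (K.subst σ)) ∪
          (((FClause.subst (renameSub ρ) D).subst σ).erase (L.subst σ))

def R1Valid (S : Set FClause) (π : List FClause) : Prop :=
  ∀ i < π.length,
    π[i]! ∈ S ∨ (∃ j < i, IsFactor π[j]! π[i]!) ∨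
      (∃ j < i, ∃ k < i, IsResolvent π[j]! π[k]! π[i]!)

def R1Refutation (S : Set FClause) (π : List FClause) : Prop :=
  R1Valid S π ∧ π ≠ [] ∧ π.getLast! = (∅ : FClause)

noncomputable def r1Size (π : List FClause) : ℕ := (π.map FClause.symSize).sum

/-- Tree-form R1 refutations: every clause occurrence is used at most once
as a premise, which is inherent in a tree-structured derivation. -/
inductive R1Tree (S : Set FClause) : FClause → Type
  | input (C : FClause) (h : C ∈ S) : R1Tree S C
  | factor {C : FClause} (t : R1Tree S C) (D : FClause) (h : IsFactor C D) : R1Tree S D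
  | resolve {C D : FClause} (t₁ : R1Tree S C) (t₂ : R1Tree S D) (E : FClause)
      (h : IsResolvent C D E) : R1Tree S E

noncomputable def R1Tree.size {S : Set FClause} : {C : FClause} → R1Tree S C → ℕ
  | C, .input _ _ => C.symSize
  | D, .factor t _ _ => t.size + D.symSize
  | E, .resolve t₁ t₂ _ _ => t₁.size + t₂.size + E.symSize

def R1Tree.clauseCount {S : Set FClause} : {C : FClause} → R1Tree S C → ℕ
  | _, .input _ _ => 1
  | _, .factor t _ _ => t.clauseCount + 1
  | _, .resolve t₁ t₂ _ _ => t₁.clauseCount + t₂.clauseCount + 1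

/-! ## The Skolem and EPR translations -/

/-- The universal variables strictly preceding `a` in the prefix,
in prefix order. -/
def PCNF.univBefore (Φ : PCNF) (a : ℕ) : List ℕ :=
  ((Φ.blocks.flatMap fun b => b.2.map fun x => (b.1, x)).takeWhile
      fun p => p.2 ≠ a).filterMap
    fun p => if p.1 = false then some p.2 else none

/-- `p` is the predicate symbol `0`; `f₀`, `f₁` are the constants `0`, `1`;
the Skolem function symbol for existential variable `a` is `a + 2`. -/
def skAtom (Φ : PCNF) (x : ℕ) : FAtom :=
  if Φ.existB x then ⟨0, [FTerm.app (x + 2) ((Φ.univBefore x).map FTerm.var)]⟩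
  else ⟨0, [FTerm.var x]⟩

def skLit (Φ : PCNF) : Lit → FLit
  | .pos x => .pos (skAtom Φ x)
  | .neg x => .neg (skAtom Φ x)

noncomputable def skClause (Φ : PCNF) (C : Clause) : FClause := C.image (skLit Φ)

def pf1Cl : FClause := {FLit.pos ⟨0, [FTerm.app 1 []]⟩}
def npf0Cl : FClause := {FLit.neg ⟨0, [FTerm.app 0 []]⟩}

/-- The clause set `Sk(Φ) ∪ {p(f₁), ¬p(f₀)}`. -/
noncomputable def skSet (Φ : PCNF) : Set FClause :=
  ↑(Φ.matrix.image (skClause Φ)) ∪ {pf1Cl, npf0Cl}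

/-- EPR atom: `p(f_a(u₁,…,u_k))` with `k ≥ 1` becomes `p_a(u₁,…,u_k)`,
where the fresh predicate symbol `p_a` is `a + 1`. -/
def eprAtom (Φ : PCNF) (x : ℕ) : FAtom :=
  if Φ.existB x then
    if Φ.univBefore x = [] then ⟨0, [FTerm.app (x + 2) []]⟩
    else ⟨x + 1, (Φ.univBefore x).map FTerm.var⟩
  else ⟨0, [FTerm.var x]⟩

def eprLit (Φ : PCNF) : Lit → FLit
  | .pos x => .pos (eprAtom Φ x)
  | .neg x => .neg (eprAtom Φ x)

noncomputable def eprClause (Φ : PCNF) (C : Clause) : FClause := C.image (eprLit Φ)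

/-- The clause set `EPR(Φ) ∪ {p(f₁), ¬p(f₀)}`. -/
noncomputable def eprSet (Φ : PCNF) : Set FClause :=
  ↑(Φ.matrix.image (eprClause Φ)) ∪ {pf1Cl, npf0Cl}

/-! ## IR-calc and its extensions -/

/-- An annotation: a (functional) finite set of assignments
`universal variable ↦ 0/1` (`false` = 0, `true` = 1). -/
abbrev Ann := Finset (ℕ × Bool)

def Ann.Functional (τ : Ann) : Prop := ∀ x b b', (x, b) ∈ τ → (x, b') ∈ τ → b = b'

/-- Restriction `[σ]` of an annotation to the universal variables of level
below the level of the literal `l`. -/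
def annRestr (Φ : PCNF) (σ : Ann) (l : Lit) : Ann :=
  σ.filter fun p => Φ.lv p.1 < Φ.lv l.var

/-- Completion of `μ` by `τ`. -/
def annCompl (μ τ : Ann) : Ann :=
  μ ∪ τ.filter fun p => p.1 ∉ μ.image Prod.fst

structure ALit where
  lit : Lit
  ann : Ann
deriving DecidableEq

abbrev AClause := Finset ALit

def ALit.symSize (al : ALit) : ℕ := 1 + 2 * al.ann.card
def AClause.symSize (A : AClause) : ℕ := ∑ al ∈ A, al.symSize
def aSize (π : List AClause) : ℕ := (π.map AClause.symSize).sum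

/-- The annotation extracted from the universal literals of a clause:
`u ↦ 0` for positive and `u ↦ 1` for negative universal literals. -/
def axAnn (Φ : PCNF) (C : Clause) : Ann :=
  (C.filter fun l => Φ.univB l.var).image fun l =>
    match l with
    | .pos u => (u, false)
    | .neg u => (u, true)

/-- The axiom clause of IR-calc obtained from a matrix clause. -/
def axClause (Φ : PCNF) (C : Clause) : AClause :=
  (C.filter fun l => Φ.existB l.var).image fun l => ⟨l, annRestr Φ (axAnn Φ C) l⟩

/-- Application of a variable substitution `σ_v` (universal ↦ existential)
to a literal. -/
def applySigv (σv : ℕ → Option ℕ) : Lit → Lit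
  | .pos x => match σv x with | some e => .pos e | none => .pos x
  | .neg x => match σv x with | some e => .neg e | none => .neg x

def Clause.applySigv (σv : ℕ → Option ℕ) (C : Clause) : Clause :=
  C.image (_root_.applySigv σv)

/-- Admissibility of `σ_v`: it maps universal variables to existential
variables of strictly smaller level. -/
def Admissible (Φ : PCNF) (σv : ℕ → Option ℕ) : Prop :=
  ∀ x e, σv x = some e → Φ.univB x = true ∧ Φ.existB e = true ∧ Φ.lv e < Φ.lv x

/-- One step of IR-calc(P, M, Δ, σ_v).  Plain IR-calc is the instance with
`Δ = ∅` and `σv = fun _ => none`; IR-calc^{σ_v} the instance with `Δ = ∅`. -/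
inductive IRStep (Φ : PCNF) (Δ : Finset Clause) (σv : ℕ → Option ℕ)
    (prev : List AClause) : AClause → Prop
  | ax (C : Clause) (hC : C ∈ Φ.matrix) (hnt : ¬ C.Taut)
      (hnt' : ¬ (C.applySigv σv).Taut) :
      IRStep Φ Δ σv prev (axClause Φ (C.applySigv σv))
  | axExt (C : Clause) (hC : C ∈ Δ) (hnt : ¬ C.Taut) :
      IRStep Φ Δ σv prev (C.image fun l => ⟨l, ∅⟩)
  | res (x : ℕ) (τ : Ann) (A B : AClause) (hA : A ∈ prev) (hB : B ∈ prev)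
      (hxa : (⟨Lit.pos x, τ⟩ : ALit) ∈ A) (hxb : (⟨Lit.neg x, τ⟩ : ALit) ∈ B) :
      IRStep Φ Δ σv prev ((A.erase ⟨Lit.pos x, τ⟩) ∪ (B.erase ⟨Lit.neg x, τ⟩))
  | fac (A : AClause) (hA : A ∈ prev) : IRStep Φ Δ σv prev A
  | inst (A : AClause) (τ : Ann) (hA : A ∈ prev) (hfun : τ.Functional)
      (hdom : ∀ p ∈ τ, Φ.univB p.1 = true) :
      IRStep Φ Δ σv prev
        (A.image fun al => ⟨al.lit, annRestr Φ (annCompl al.ann τ) al.lit⟩)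

def IRValid (Φ : PCNF) (Δ : Finset Clause) (σv : ℕ → Option ℕ)
    (π : List AClause) : Prop :=
  ∀ i < π.length, IRStep Φ Δ σv (π.take i) π[i]!

def IRRefutation (Φ : PCNF) (Δ : Finset Clause) (σv : ℕ → Option ℕ)
    (π : List AClause) : Prop :=
  IRValid Φ Δ σv π ∧ π ≠ [] ∧ π.getLast! = (∅ : AClause)

def noSub : ℕ → Option ℕ := fun _ => none

/-- Tree-form IR-calc(P, M, Δ, σ_v) derivations. -/
inductive IRTree (Φ : PCNF) (Δ : Finset Clause) (σv : ℕ → Option ℕ) : AClause → Type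
  | ax (C : Clause) (hC : C ∈ Φ.matrix) (hnt : ¬ C.Taut)
      (hnt' : ¬ (C.applySigv σv).Taut) : IRTree Φ Δ σv (axClause Φ (C.applySigv σv))
  | axExt (C : Clause) (hC : C ∈ Δ) (hnt : ¬ C.Taut) :
      IRTree Φ Δ σv (C.image fun l => ⟨l, ∅⟩)
  | res {A B : AClause} (t₁ : IRTree Φ Δ σv A) (t₂ : IRTree Φ Δ σv B)
      (x : ℕ) (τ : Ann)
      (hxa : (⟨Lit.pos x, τ⟩ : ALit) ∈ A) (hxb : (⟨Lit.neg x, τ⟩ : ALit) ∈ B) :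
      IRTree Φ Δ σv ((A.erase ⟨Lit.pos x, τ⟩) ∪ (B.erase ⟨Lit.neg x, τ⟩))
  | inst {A : AClause} (t : IRTree Φ Δ σv A) (τ : Ann) (hfun : τ.Functional)
      (hdom : ∀ p ∈ τ, Φ.univB p.1 = true) :
      IRTree Φ Δ σv (A.image fun al => ⟨al.lit, annRestr Φ (annCompl al.ann τ) al.lit⟩)

def IRTree.size {Φ : PCNF} {Δ : Finset Clause} {σv : ℕ → Option ℕ} :
    {A : AClause} → IRTree Φ Δ σv A → ℕ
  | _, .ax C _ _ _ => AClause.symSize (axClause Φ (C.applySigv σv))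
  | _, .axExt C _ _ => AClause.symSize (C.image fun l => (⟨l, ∅⟩ : ALit))
  | _, .res (A := A) (B := B) t₁ t₂ x τ _ _ =>
      t₁.size + t₂.size +
        AClause.symSize ((A.erase ⟨Lit.pos x, τ⟩) ∪ (B.erase ⟨Lit.neg x, τ⟩))
  | _, .inst (A := A) t τ _ _ =>
      t.size + AClause.symSize (A.image fun al =>
        (⟨al.lit, annRestr Φ (annCompl al.ann τ) al.lit⟩ : ALit))

/-! ## The formula families Φ_n and Ω_n (pigeonhole based) -/

def xv (i j : ℕ) : ℕ := Nat.pair 0 (Nat.pair i (Nat.pair j 0))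
def yv (i j : ℕ) : ℕ := Nat.pair 1 (Nat.pair i (Nat.pair j 0))
def zv (i₁ i₂ j : ℕ) : ℕ := Nat.pair 2 (Nat.pair i₁ (Nat.pair i₂ j))

def Xlist (n : ℕ) : List ℕ :=
  (List.range (n+1)).flatMap fun i => (List.range n).map fun j => xv (i+1) (j+1)
def Ylist (n : ℕ) : List ℕ :=
  (List.range (n+1)).flatMap fun i => (List.range n).map fun j => yv (i+1) (j+1)
def Zlist (n : ℕ) : List ℕ :=
  ((List.range (n+1)).map fun i => zv (i+1) 0 0) ++
  ((List.range n).flatMap fun j => (List.range (n+1)).flatMap fun i₁ =>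
    (List.range (n+1)).filterMap fun i₂ =>
      if i₁ < i₂ then some (zv (i₁+1) (i₂+1) (j+1)) else none)

/-- The clauses of PHP_n(X_n). -/
def PHPcls (n : ℕ) : Finset Clause :=
  ((List.range (n+1)).map fun i =>
      (((List.range n).map fun j => Lit.pos (xv (i+1) (j+1))).toFinset : Clause)).toFinset ∪
  ((List.range n).flatMap fun j => (List.range (n+1)).flatMap fun i₁ =>
    (List.range (n+1)).filterMap fun i₂ =>
      if i₁ < i₂ then
        some ({Lit.neg (xv (i₁+1) (j+1)), Lit.neg (xv (i₂+1) (j+1))} : Clause)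
      else none).toFinset

/-- The clauses of TPHP′_n(Y_n, Z_n). -/
def TPHPcls (n : ℕ) : Finset Clause :=
  {(((Zlist n).map Lit.neg).toFinset : Clause)} ∪
  ((List.range (n+1)).flatMap fun i => (List.range n).map fun j =>
      ({Lit.pos (zv (i+1) 0 0), Lit.neg (yv (i+1) (j+1))} : Clause)).toFinset ∪
  ((List.range n).flatMap fun j => (List.range (n+1)).flatMap fun i₁ =>
    (List.range (n+1)).flatMap fun i₂ =>
      if i₁ < i₂ then
        [({Lit.pos (zv (i₁+1) (i₂+1) (j+1)), Lit.pos (yv (i₁+1) (j+1))} : Clause),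
         ({Lit.pos (zv (i₁+1) (i₂+1) (j+1)), Lit.pos (yv (i₂+1) (j+1))} : Clause)]
      else []).toFinset

def phiMatrix (n : ℕ) : Finset Clause := TPHPcls n ∪ PHPcls n

/-- Φ_n = ∃X_n ∀Y_n ∃Z_n (TPHP′_n ∧ PHP_n). -/
def PhiF (n : ℕ) : PCNF :=
  ⟨[(true, Xlist n), (false, Ylist n), (true, Zlist n)], phiMatrix n⟩

/-- Ω_n = ∀Y_n ∃Z_n ∃X_n (TPHP′_n ∧ PHP_n) (Z_n and X_n form one block). -/
def OmegaF (n : ℕ) : PCNF :=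
  ⟨[(false, Ylist n), (true, Zlist n ++ Xlist n)], phiMatrix n⟩

/-! ## The formula family Ψ_t of Kleine Büning, Karpinski and Flögel -/

def dv (j : ℕ) : ℕ := 5*j
def ev (j : ℕ) : ℕ := 5*j+1
def xvv (j : ℕ) : ℕ := 5*j+2
def fv (j : ℕ) : ℕ := 5*j+3
def qv (j : ℕ) : ℕ := 5*j+4

/-- The prefix P_t; if `withQ` is set, the fresh extension variable `q_i`
is placed in the same existential block as `d_i` and `e_i`. -/
def psiPrefix (t : ℕ) (withQ : Bool) : List (Bool × List ℕ) :=
  ((true, [dv 0, dv 1, ev 1] ++ if withQ then [qv 1] else []) ::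
    (List.range (t-1)).flatMap fun j =>
      [(false, [xvv (j+1)]),
       (true, [dv (j+2), ev (j+2)] ++ if withQ then [qv (j+2)] else [])]) ++
  [(false, [xvv t]), (true, (List.range t).map fun i => fv (i+1))]

def fNegs (t : ℕ) : List Lit := (List.range t).map fun i => Lit.neg (fv (i+1))

def psiMatrix (t : ℕ) : Finset Clause :=
  ({({Lit.neg (dv 0)} : Clause),
    ({Lit.pos (dv 0), Lit.neg (dv 1), Lit.neg (ev 1)} : Clause),
    (((Lit.pos (dv t) :: Lit.neg (xvv t) :: fNegs t).toFinset : Clause)),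
    (((Lit.pos (ev t) :: Lit.pos (xvv t) :: fNegs t).toFinset : Clause))} : Finset Clause) ∪
  ((List.range (t-1)).flatMap fun j =>
     [({Lit.pos (dv (j+1)), Lit.neg (xvv (j+1)), Lit.neg (dv (j+2)), Lit.neg (ev (j+2))} : Clause),
      ({Lit.pos (ev (j+1)), Lit.pos (xvv (j+1)), Lit.neg (dv (j+2)), Lit.neg (ev (j+2))} : Clause)]).toFinset ∪
  ((List.range t).flatMap fun j =>
     [({Lit.neg (xvv (j+1)), Lit.pos (fv (j+1))} : Clause),
      ({Lit.pos (xvv (j+1)), Lit.pos (fv (j+1))} : Clause)]).toFinset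

def PsiF (t : ℕ) : PCNF := ⟨psiPrefix t false, psiMatrix t⟩

/-- Ψ_t with the extension variables q_i added to the prefix. -/
def PsiFq (t : ℕ) : PCNF := ⟨psiPrefix t true, psiMatrix t⟩

/-- The extension clauses Δ: clausal form of q_i ↔ (¬d_i ∧ e_i), 1 ≤ i ≤ t. -/
def DeltaT (t : ℕ) : Finset Clause :=
  ((List.range t).flatMap fun i =>
    [({Lit.pos (qv (i+1)), Lit.pos (dv (i+1)), Lit.neg (ev (i+1))} : Clause),
     ({Lit.neg (qv (i+1)), Lit.neg (dv (i+1))} : Clause),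
     ({Lit.neg (qv (i+1)), Lit.pos (ev (i+1))} : Clause)]).toFinset

/-- σ_{v,t} = { x_i ↦ q_i : 1 ≤ i ≤ t }. -/
def sigmaQv (t : ℕ) : ℕ → Option ℕ := fun v =>
  if v % 5 = 2 ∧ 1 ≤ v / 5 ∧ v / 5 ≤ t then some (5 * (v / 5) + 4) else none

/-- σ_{v,t} = { x_i ↦ e_i : 1 ≤ i ≤ t }. -/
def sigmaEv (t : ℕ) : ℕ → Option ℕ := fun v =>
  if v % 5 = 2 ∧ 1 ≤ v / 5 ∧ v / 5 ≤ t then some (5 * (v / 5) + 1) else none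

/-! ## Proof: levels in Ω_n -/

namespace OmegaLB

lemma xv_inj {i j i' j' : ℕ} (h : xv i j = xv i' j') : i = i' ∧ j = j' := by
  simpa [xv, Nat.pair_eq_pair] using h

lemma mem_Ylist {n x : ℕ} : x ∈ Ylist n ↔ ∃ i < n + 1, ∃ j < n, x = yv (i+1) (j+1) := by
  simp [Ylist, eq_comm]

lemma mem_Xlist {n x : ℕ} : x ∈ Xlist n ↔ ∃ i < n + 1, ∃ j < n, x = xv (i+1) (j+1) := by
  simp [Xlist, eq_comm]

lemma mem_Zlist {n x : ℕ} : x ∈ Zlist n ↔ (∃ i < n + 1, x = zv (i+1) 0 0) ∨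
    ∃ j < n, ∃ i₁ < n + 1, ∃ i₂ < n + 1, i₁ < i₂ ∧ x = zv (i₁+1) (i₂+1) (j+1) := by
  simp [Zlist, eq_comm]

lemma tag_Y {n x : ℕ} (h : x ∈ Ylist n) : x.unpair.1 = 1 := by
  obtain ⟨i, _, j, _, rfl⟩ := mem_Ylist.1 h
  simp [yv]

lemma lv_Y {n x : ℕ} (h : x ∈ Ylist n) : (OmegaF n).lv x = 0 := by
  simp [PCNF.lv, OmegaF, List.findIdx_cons, h]

lemma lv_notY {n x : ℕ} (h : x ∉ Ylist n) : 0 < (OmegaF n).lv x := by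
  simp [PCNF.lv, OmegaF, List.findIdx_cons, h]

lemma lv_pos_of_tag {n x : ℕ} (h : x.unpair.1 ≠ 1) : 0 < (OmegaF n).lv x :=
  lv_notY fun h' => h (tag_Y h')

lemma univB_iff {n x : ℕ} : (OmegaF n).univB x = true ↔ x ∈ Ylist n := by
  simp [PCNF.univB, OmegaF]

lemma existB_iff {n x : ℕ} : (OmegaF n).existB x = true ↔ x ∈ Zlist n ∨ x ∈ Xlist n := by
  simp [PCNF.existB, OmegaF]

lemma sigv_none {n : ℕ} {σv : ℕ → Option ℕ} (h : Admissible (OmegaF n) σv) (x : ℕ) :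
    σv x = none := by
  cases hx : σv x with
  | none => rfl
  | some e =>
    obtain ⟨h1, _, h3⟩ := h x e hx
    rw [lv_Y (univB_iff.1 h1)] at h3
    omega

lemma applySigv_id {n : ℕ} {σv : ℕ → Option ℕ} (h : Admissible (OmegaF n) σv) (C : Clause) :
    C.applySigv σv = C := by
  have : ∀ l, _root_.applySigv σv l = l := by
    intro l
    cases l <;> simp [_root_.applySigv, sigv_none h]
  have h2 : _root_.applySigv σv = id := funext this
  simp [Clause.applySigv, h2]

/-! ## Valuations -/

/-- Completion of an annotation `μ` by a total assignment, on universal variables. -/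
noncomputable def compl (n : ℕ) (μ : Ann) (β : ℕ → Bool) : ℕ → Bool := fun y =>
  if 0 < (OmegaF n).lv y then β y
  else if (y, true) ∈ μ then true else if (y, false) ∈ μ then false else β y

open Classical in
/-- Total assignment from a placement `f` of holes to pigeons and an assignment `α` of `Y`. -/
noncomputable def W (n : ℕ) (f : Fin n → Fin (n+1)) (α : ℕ → Bool) : ℕ → Bool := fun x =>
  if x.unpair.1 = 0 then decide (∃ j : Fin n, x = xv ((f j : ℕ) + 1) ((j : ℕ) + 1))
  else if x.unpair.1 = 1 then α x
  else if x.unpair.2.unpair.2.unpair.1 = 0 then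
    decide (∃ j < n, α (yv x.unpair.2.unpair.1 (j+1)) = true)
  else !(α (yv x.unpair.2.unpair.1 x.unpair.2.unpair.2.unpair.2) &&
    α (yv x.unpair.2.unpair.2.unpair.1 x.unpair.2.unpair.2.unpair.2))

lemma W_x (n f α) (i j : ℕ) : W n f α (xv i j) = true ↔
    ∃ j' : Fin n, i = (f j' : ℕ) + 1 ∧ j = (j' : ℕ) + 1 := by
  simp [W, xv, Nat.pair_eq_pair]

lemma W_y (n f α) (i j : ℕ) : W n f α (yv i j) = α (yv i j) := by
  simp [W, yv]

lemma W_z0 (n f α) (i j : ℕ) : W n f α (zv i 0 j) = true ↔ ∃ j < n, α (yv i (j+1)) = true := by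
  simp [W, zv]

lemma W_z (n f α) (i k j : ℕ) : W n f α (zv i (k+1) j) = !(α (yv i j) && α (yv (k+1) j)) := by
  simp [W, zv]

lemma W_tag (n f f' α) (x : ℕ) (h : x.unpair.1 ≠ 0) : W n f α x = W n f' α x := by
  simp [W, h]

/-- Annotated clause satisfied. -/
def Sat (n : ℕ) (f : Fin n → Fin (n+1)) (β : ℕ → Bool) (A : AClause) : Prop :=
  ∃ al ∈ A, 0 < (OmegaF n).lv al.lit.var ∧ al.lit.eval (W n f (compl n al.ann β)) = true

lemma tphp_sat (n : ℕ) (f : Fin n → Fin (n+1)) (α : ℕ → Bool) (C : Clause)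
    (hC : C ∈ TPHPcls n) : evalClause (W n f α) C := by
  simp only [TPHPcls, Finset.mem_union, Finset.mem_singleton, List.mem_toFinset,
    List.mem_flatMap, List.mem_map, List.mem_range] at hC
  rcases hC with (rfl | ⟨i, hi, j, hj, rfl⟩) | ⟨j, hj, i₁, h1, i₂, h2, h⟩
  · by_contra hcon
    have hall : ∀ z ∈ Zlist n, W n f α z = true := by
      intro z hz
      by_contra hz'
      exact hcon ⟨Lit.neg z, by simp [hz], by simpa [Lit.eval] using hz'⟩
    have h1 : ∀ i : Fin (n+1), ∃ j : Fin n, α (yv (i+1) (j+1)) = true := by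
      intro i
      obtain ⟨j, hj, h⟩ := (W_z0 n f α _ 0).1 (hall (zv (i+1) 0 0)
        (mem_Zlist.2 (Or.inl ⟨i, i.2, rfl⟩)))
      exact ⟨⟨j, hj⟩, h⟩
    choose g hg using h1
    obtain ⟨a, b, hab, hgab⟩ := Fintype.exists_ne_map_eq_of_card_lt g (by simp)
    have key : ∀ a b : Fin (n+1), a < b → g a = g b → False := by
      intro a b hlt hgab
      have h2 := hall (zv (a+1) (b+1) (g a + 1))
        (mem_Zlist.2 (Or.inr ⟨g a, (g a).2, a, a.2, b, b.2, hlt, rfl⟩))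
      rw [W_z] at h2
      have h3 := hg a
      have h4 := hg b
      rw [← hgab] at h4
      simp [h3, h4] at h2
    rcases lt_or_gt_of_ne hab with h | h
    · exact key a b h hgab
    · exact key b a h hgab.symm
  · by_cases hy : α (yv (i+1) (j+1)) = true
    · exact ⟨Lit.pos (zv (i+1) 0 0), by simp, (W_z0 n f α _ 0).2 ⟨j, hj, hy⟩⟩
    · exact ⟨Lit.neg (yv (i+1) (j+1)), by simp, by simpa [Lit.eval, W_y] using hy⟩
  · split_ifs at h with hlt
    · simp only [List.mem_cons, List.not_mem_nil, or_false] at h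
      rcases h with rfl | rfl
      · by_cases hy : α (yv (i₁+1) (j+1)) = true
        · exact ⟨Lit.pos (yv (i₁+1) (j+1)), by simp, by simpa [Lit.eval, W_y] using hy⟩
        · exact ⟨Lit.pos (zv (i₁+1) (i₂+1) (j+1)), by simp, by simp [Lit.eval, W_z, hy]⟩
      · by_cases hy : α (yv (i₂+1) (j+1)) = true
        · exact ⟨Lit.pos (yv (i₂+1) (j+1)), by simp, by simpa [Lit.eval, W_y] using hy⟩
        · exact ⟨Lit.pos (zv (i₁+1) (i₂+1) (j+1)), by simp, by simp [Lit.eval, W_z, hy]⟩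
    · simp at h

lemma matrix_sat (n : ℕ) (C : Clause) (hC : C ∈ phiMatrix n) :
    ∃ i₀ : Fin (n+1), ∀ (f : Fin n → Fin (n+1)) (α : ℕ → Bool), Function.Injective f →
      (∃ j, f j = i₀) → evalClause (W n f α) C := by
  rcases Finset.mem_union.1 hC with hC | hC
  · exact ⟨0, fun f α _ _ => tphp_sat n f α C hC⟩
  · simp only [PHPcls, Finset.mem_union, List.mem_toFinset, List.mem_flatMap, List.mem_map,
      List.mem_range, List.mem_filterMap] at hC
    rcases hC with ⟨i, hi, rfl⟩ | ⟨j, hj, i₁, h1, i₂, h2, h⟩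
    · refine ⟨⟨i, hi⟩, fun f α _ ⟨j, hj⟩ => ⟨Lit.pos (xv (i+1) (j+1)), ?_, ?_⟩⟩
      · simp only [List.mem_toFinset, List.mem_map, List.mem_range]
        exact ⟨j, j.2, rfl⟩
      exact (W_x n f α _ _).2 ⟨j, by simp [hj], rfl⟩
    · split_ifs at h with hlt
      · simp only [Option.some.injEq] at h
        subst h
        refine ⟨0, fun f α hf _ => ?_⟩
        by_cases hx : W n f α (xv (i₁+1) (j+1)) = true
        · refine ⟨Lit.neg (xv (i₂+1) (j+1)), by simp, ?_⟩
          obtain ⟨a, ha, ha'⟩ := (W_x n f α _ _).1 hx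
          by_contra hc
          have hc : W n f α (xv (i₂+1) (j+1)) = true := by simpa [Lit.eval] using hc
          obtain ⟨b, hb, hb'⟩ := (W_x n f α _ _).1 hc
          have : a = b := Fin.ext (by omega)
          subst this
          omega
        · exact ⟨Lit.neg (xv (i₁+1) (j+1)), by simp, by simpa [Lit.eval] using hx⟩

lemma matrix_closed (n : ℕ) (C : Clause) (hC : C ∈ phiMatrix n) (l : Lit) (hl : l ∈ C) :
    l.var ∈ Ylist n ∨ l.var ∈ Zlist n ∨ l.var ∈ Xlist n := by
  simp only [phiMatrix, TPHPcls, PHPcls, Finset.mem_union, Finset.mem_singleton,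
    List.mem_toFinset, List.mem_flatMap, List.mem_map, List.mem_range, List.mem_filterMap] at hC
  rcases hC with ((rfl | ⟨i, hi, j, hj, rfl⟩) | ⟨j, hj, i₁, h1, i₂, h2, h⟩) |
    (⟨i, hi, rfl⟩ | ⟨j, hj, i₁, h1, i₂, h2, h⟩)
  · simp only [List.mem_toFinset, List.mem_map] at hl
    obtain ⟨z, hz, rfl⟩ := hl
    exact Or.inr (Or.inl hz)
  · simp only [Finset.mem_insert, Finset.mem_singleton] at hl
    rcases hl with rfl | rfl
    · exact Or.inr (Or.inl (mem_Zlist.2 (Or.inl ⟨i, hi, rfl⟩)))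
    · exact Or.inl (mem_Ylist.2 ⟨i, hi, j, hj, rfl⟩)
  · split_ifs at h with hlt
    · simp only [List.mem_cons, List.not_mem_nil, or_false] at h
      have hz : zv (i₁+1) (i₂+1) (j+1) ∈ Zlist n :=
        mem_Zlist.2 (Or.inr ⟨j, hj, i₁, h1, i₂, h2, hlt, rfl⟩)
      rcases h with rfl | rfl <;> simp only [Finset.mem_insert, Finset.mem_singleton] at hl <;>
        rcases hl with rfl | rfl
      · exact Or.inr (Or.inl hz)
      · exact Or.inl (mem_Ylist.2 ⟨i₁, h1, j, hj, rfl⟩)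
      · exact Or.inr (Or.inl hz)
      · exact Or.inl (mem_Ylist.2 ⟨i₂, h2, j, hj, rfl⟩)
    · simp at h
  · simp only [List.mem_toFinset, List.mem_map, List.mem_range] at hl
    obtain ⟨j, hj, rfl⟩ := hl
    exact Or.inr (Or.inr (mem_Xlist.2 ⟨i, hi, j, hj, rfl⟩))
  · split_ifs at h with hlt
    simp only [Option.some.injEq] at h
    subst h
    simp only [Finset.mem_insert, Finset.mem_singleton] at hl
    rcases hl with rfl | rfl
    · exact Or.inr (Or.inr (mem_Xlist.2 ⟨i₁, h1, j, hj, rfl⟩))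
    · exact Or.inr (Or.inr (mem_Xlist.2 ⟨i₂, h2, j, hj, rfl⟩))

lemma mem_axAnn {n : ℕ} {C : Clause} {y : ℕ} {b : Bool} (h : y ∈ Ylist n) :
    (y, b) ∈ axAnn (OmegaF n) C ↔ (if b then Lit.neg y else Lit.pos y) ∈ C := by
  simp only [axAnn, Finset.mem_image, Finset.mem_filter]
  constructor
  · rintro ⟨l, ⟨hl, _⟩, he⟩
    cases l <;> simp only [Prod.mk.injEq] at he <;> obtain ⟨rfl, rfl⟩ := he <;> simpa using hl
  · intro hl
    refine ⟨_, ⟨hl, ?_⟩, ?_⟩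
    · cases b <;> simp [Lit.var, univB_iff, h]
    · cases b <;> simp

lemma compl_restr {n : ℕ} {μ : Ann} {l : Lit} (hl : 0 < (OmegaF n).lv l.var) (β : ℕ → Bool) :
    compl n (annRestr (OmegaF n) μ l) β = compl n μ β := by
  funext y
  simp only [compl]
  split_ifs with h0 <;> simp_all [annRestr]

lemma compl_compl {n : ℕ} {μ τ : Ann} (β : ℕ → Bool) :
    compl n (annCompl μ τ) β = compl n μ (compl n τ β) := by
  funext y
  simp only [compl, annCompl, Finset.mem_union, Finset.mem_filter, Finset.mem_image, Prod.exists,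
    exists_and_right, exists_eq_right]
  by_cases h0 : 0 < (OmegaF n).lv y
  · simp [h0]
  · by_cases h1 : (y, true) ∈ μ <;> by_cases h2 : (y, false) ∈ μ <;> simp [h0, h1, h2]

lemma ax_sat (n : ℕ) (C : Clause) (hC : C ∈ phiMatrix n) (hnt : ¬ C.Taut)
    (f : Fin n → Fin (n+1)) (β : ℕ → Bool)
    (h : evalClause (W n f (compl n (axAnn (OmegaF n) C) β)) C) :
    Sat n f β (axClause (OmegaF n) C) := by
  obtain ⟨l, hl, hev⟩ := h
  by_cases hY : l.var ∈ Ylist n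
  · exfalso
    have h0 := lv_Y hY
    have hy1 := tag_Y hY
    cases l with
    | pos y =>
      simp only [Lit.var] at hY h0 hy1
      have h1 : (y, true) ∉ axAnn (OmegaF n) C := fun h' =>
        hnt ⟨y, hl, by simpa using (mem_axAnn hY).1 h'⟩
      have h2 : (y, false) ∈ axAnn (OmegaF n) C := (mem_axAnn hY).2 (by simpa using hl)
      simp [Lit.eval, W, hy1, compl, h0, h1, h2] at hev
    | neg y =>
      simp only [Lit.var] at hY h0 hy1
      have h2 : (y, true) ∈ axAnn (OmegaF n) C := (mem_axAnn hY).2 (by simpa using hl)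
      simp [Lit.eval, W, hy1, compl, h0, h2] at hev
  · have hlv := lv_notY hY
    refine ⟨⟨l, annRestr (OmegaF n) (axAnn (OmegaF n) C) l⟩, ?_, hlv, ?_⟩
    · refine Finset.mem_image.2 ⟨l, Finset.mem_filter.2 ⟨hl, ?_⟩, rfl⟩
      exact existB_iff.2 ((matrix_closed n C hC l hl).resolve_left hY)
    · simpa [compl_restr hlv] using hev

lemma inst_sat (n : ℕ) (A : AClause) (τ : Ann) (f : Fin n → Fin (n+1)) (β : ℕ → Bool)
    (h : Sat n f (compl n τ β) A) :
    Sat n f β (A.image fun al =>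
      ⟨al.lit, annRestr (OmegaF n) (annCompl al.ann τ) al.lit⟩) := by
  obtain ⟨al, hal, hlv, hev⟩ := h
  refine ⟨_, Finset.mem_image_of_mem _ hal, hlv, ?_⟩
  simpa [compl_restr hlv, compl_compl] using hev

lemma res_sat (n : ℕ) (A B : AClause) (x : ℕ) (τ : Ann) (f : Fin n → Fin (n+1)) (β : ℕ → Bool)
    (hA : Sat n f β A) (hB : Sat n f β B) :
    Sat n f β ((A.erase ⟨Lit.pos x, τ⟩) ∪ (B.erase ⟨Lit.neg x, τ⟩)) := by
  obtain ⟨a, ha, hla, hea⟩ := hA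
  obtain ⟨b, hb, hlb, heb⟩ := hB
  by_cases h1 : a = ⟨Lit.pos x, τ⟩
  · by_cases h2 : b = ⟨Lit.neg x, τ⟩
    · subst h1 h2
      simp [Lit.eval] at hea heb
      simp [hea] at heb
    · exact ⟨b, by simp [h2, hb], hlb, heb⟩
  · exact ⟨a, by simp [h1, ha], hla, hea⟩

/-! ## Monotone clauses, missed pigeons -/

open Classical in
noncomputable def Plus (n : ℕ) (A : AClause) : Finset (Fin (n+1) × Fin n) :=
  Finset.univ.filter fun p =>
    (∃ μ, (⟨Lit.pos (xv ((p.1 : ℕ)+1) ((p.2 : ℕ)+1)), μ⟩ : ALit) ∈ A) ∨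
    ∃ i' : Fin (n+1), i' ≠ p.1 ∧
      ∃ μ, (⟨Lit.neg (xv ((i' : ℕ)+1) ((p.2 : ℕ)+1)), μ⟩ : ALit) ∈ A

lemma lv_x (n i j : ℕ) : 0 < (OmegaF n).lv (xv i j) := lv_pos_of_tag (by simp [xv])

lemma not_sat_plus {n : ℕ} {A : AClause} {f : Fin n → Fin (n+1)} {β : ℕ → Bool}
    (h : ¬ Sat n f β A) (j : Fin n) : (f j, j) ∉ Plus n A := by
  intro hm
  simp only [Plus, Finset.mem_filter, Finset.mem_univ, true_and] at hm
  rcases hm with ⟨μ, hμ⟩ | ⟨i', hi', μ, hμ⟩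
  · exact h ⟨_, hμ, lv_x _ _ _, (W_x n f _ _ _).2 ⟨j, rfl, rfl⟩⟩
  · refine h ⟨_, hμ, lv_x _ _ _, ?_⟩
    by_contra hc
    have hc : W n f (compl n μ β) (xv ((i' : ℕ)+1) ((j : ℕ)+1)) = true := by
      simpa [Lit.eval] using hc
    obtain ⟨b, hb, hb'⟩ := (W_x n f _ _ _).1 hc
    have : j = b := Fin.ext (by omega)
    subst this
    exact hi' (Fin.ext (by omega))

lemma W_x_form {n f α x} (h0 : x.unpair.1 = 0) (h : W n f α x = true) :
    ∃ j : Fin n, x = xv ((f j : ℕ)+1) ((j : ℕ)+1) := by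
  simpa [W, h0] using h

lemma switch_plus {n : ℕ} {A : AClause} {f : Fin n → Fin (n+1)} {β : ℕ → Bool}
    {i : Fin (n+1)} {j : Fin n} (hij : f j ≠ i)
    (h : ¬ Sat n f β A) (h' : Sat n (Function.update f j i) β A) : (i, j) ∈ Plus n A := by
  obtain ⟨⟨l, μ⟩, hal, hlv, hev⟩ := h'
  have hev2 : ¬ l.eval (W n f (compl n μ β)) = true := fun hh => h ⟨⟨l, μ⟩, hal, hlv, hh⟩
  simp only [Plus, Finset.mem_filter, Finset.mem_univ, true_and]
  have h0 : l.var.unpair.1 = 0 := by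
    by_contra h0
    apply hev2
    cases l with
    | pos x => simpa [Lit.eval, W_tag n f (Function.update f j i) _ x h0] using hev
    | neg x => simpa [Lit.eval, W_tag n f (Function.update f j i) _ x h0] using hev
  cases l with
  | pos x =>
    left
    obtain ⟨j', hj'⟩ := W_x_form h0 hev
    by_cases hjj : j' = j
    · subst hjj
      simp only [Function.update_self] at hj'
      subst hj'
      exact ⟨μ, hal⟩
    · exfalso
      rw [Function.update_of_ne hjj] at hj'
      subst hj'
      exact hev2 ((W_x n f _ _ _).2 ⟨j', rfl, rfl⟩)
  | neg x =>
    right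
    have hev3 : W n f (compl n μ β) x = true := by simpa [Lit.eval] using hev2
    have hev4 : ¬ W n (Function.update f j i) (compl n μ β) x = true := by
      simpa [Lit.eval] using hev
    obtain ⟨j', hj'⟩ := W_x_form h0 hev3
    by_cases hjj : j' = j
    · subst hjj
      subst hj'
      exact ⟨f j', hij, μ, hal⟩
    · exfalso
      subst hj'
      exact hev4 ((W_x n _ _ _ _).2 ⟨j', by rw [Function.update_of_ne hjj], rfl⟩)

/-- `f` is a critical assignment extending `f₀` on `D` and missing `i`. -/
def Crit {n : ℕ} (f₀ : Fin n → Fin (n+1)) (D : Finset (Fin n)) (i : Fin (n+1))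
    (f : Fin n → Fin (n+1)) : Prop :=
  Function.Injective f ∧ (∀ j ∈ D, f j = f₀ j) ∧ ∀ j, f j ≠ i

open Classical in
noncomputable def Missed {n : ℕ} (f₀ : Fin n → Fin (n+1)) (D : Finset (Fin n)) (A : AClause) :
    Finset (Fin (n+1)) :=
  Finset.univ.filter fun i => ∃ f, Crit f₀ D i f ∧ ∃ β, ¬ Sat n f β A

def FreeR {n : ℕ} (f₀ : Fin n → Fin (n+1)) (D : Finset (Fin n)) : Finset (Fin (n+1)) :=
  Finset.univ \ D.image f₀

lemma mem_FreeR {n : ℕ} {f₀ : Fin n → Fin (n+1)} {D : Finset (Fin n)} {i} :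
    i ∈ FreeR f₀ D ↔ ∀ j ∈ D, f₀ j ≠ i := by
  simp [FreeR]

def Free {n : ℕ} (f₀ : Fin n → Fin (n+1)) (D : Finset (Fin n)) : Finset (Fin (n+1) × Fin n) :=
  FreeR f₀ D ×ˢ (Finset.univ \ D)

lemma missed_sub {n : ℕ} (f₀ : Fin n → Fin (n+1)) (D : Finset (Fin n)) (A : AClause) :
    Missed f₀ D A ⊆ FreeR f₀ D := by
  intro i hi
  simp only [Missed, Finset.mem_filter, Finset.mem_univ, true_and] at hi
  obtain ⟨f, ⟨_, hD, hm⟩, _⟩ := hi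
  exact mem_FreeR.2 fun j hj => hD j hj ▸ hm j

lemma crit_surj {n : ℕ} {f : Fin n → Fin (n+1)} (hf : Function.Injective f) {i k : Fin (n+1)}
    (hm : ∀ j, f j ≠ i) (hk : k ≠ i) : ∃ j, f j = k := by
  have h : Finset.univ.image f = Finset.univ.erase i := by
    apply Finset.eq_of_subset_of_card_le
    · intro x hx
      obtain ⟨j, _, rfl⟩ := Finset.mem_image.1 hx
      simp [hm j]
    · rw [Finset.card_image_of_injective _ hf]
      simp
  have : k ∈ Finset.univ.image f := by simp [h, hk]
  simpa using this

lemma wide {n : ℕ} (hn : 0 < n) (f₀ : Fin n → Fin (n+1)) (D : Finset (Fin n)) (A : AClause) :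
    (Missed f₀ D A).card * ((FreeR f₀ D).card - (Missed f₀ D A).card) ≤
      (Plus n A ∩ Free f₀ D).card := by
  classical
  rw [← Finset.card_sdiff_of_subset (missed_sub f₀ D A), ← Finset.card_product]
  have hex : ∀ i, i ∈ Missed f₀ D A → ∃ f, Crit f₀ D i f ∧ ∃ β, ¬ Sat n f β A := by
    intro i hi
    simpa [Missed] using hi
  choose! F hF β hβ using hex
  have hg : ∀ i k, i ∈ Missed f₀ D A → k ∉ Missed f₀ D A → ∃ j, F i j = k := by
    intro i k hi hk
    exact crit_surj (hF i hi).1 (hF i hi).2.2 (fun h => hk (h ▸ hi))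
  have : Nonempty (Fin n) := ⟨⟨0, hn⟩⟩
  choose! g hg using hg
  apply Finset.card_le_card_of_injOn (fun p => (p.1, g p.1 p.2))
  · rintro ⟨i, k⟩ hp
    simp only [Finset.coe_product, Set.mem_prod, Finset.mem_coe, Finset.mem_sdiff] at hp
    obtain ⟨hi, hkR, hk⟩ := hp
    have hj := hg i k hi hk
    obtain ⟨hinj, hD, hm⟩ := hF i hi
    have hjD : g i k ∉ D := by
      intro h
      exact mem_FreeR.1 hkR _ h (by rw [← hD _ h, hj])
    have hsat : Sat n (Function.update (F i) (g i k) i) (β i) A := by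
      by_contra hns
      apply hk
      simp only [Missed, Finset.mem_filter, Finset.mem_univ, true_and]
      refine ⟨_, ⟨?_, ?_, ?_⟩, β i, hns⟩
      · intro a b hab
        by_cases ha : a = g i k <;> by_cases hb : b = g i k
        · rw [ha, hb]
        · subst ha
          rw [Function.update_self, Function.update_of_ne hb] at hab
          exact absurd hab.symm (hm b)
        · subst hb
          rw [Function.update_self, Function.update_of_ne ha] at hab
          exact absurd hab (hm a)
        · rw [Function.update_of_ne ha, Function.update_of_ne hb] at hab
          exact hinj hab
      · intro j hjd
        have hne : j ≠ g i k := by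
          rintro rfl
          exact hjD hjd
        rw [Function.update_of_ne hne, hD j hjd]
      · intro j
        by_cases hjg : j = g i k
        · subst hjg
          rw [Function.update_self]
          exact fun h => hk (h ▸ hi)
        · rw [Function.update_of_ne hjg, ← hj]
          exact fun h => hjg (hinj h)
    have := switch_plus (hm _) (hβ i hi) hsat
    simp only [Finset.coe_inter, Set.mem_inter_iff, Finset.mem_coe]
    refine ⟨this, ?_⟩
    simp only [Free, Finset.mem_product, Finset.mem_sdiff, Finset.mem_univ, true_and]
    exact ⟨missed_sub _ _ _ hi, hjD⟩
  · rintro ⟨i, k⟩ hp ⟨i', k'⟩ hp' h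
    simp only [Finset.coe_product, Set.mem_prod, Finset.mem_coe, Finset.mem_sdiff] at hp hp'
    simp only [Prod.mk.injEq] at h
    obtain ⟨rfl, h2⟩ := h
    rw [← hg i k hp.1 hp.2.2, ← hg i k' hp'.1 hp'.2.2, h2]

/-! ## The missed-pigeon measure along a refutation -/

lemma step_missed {n : ℕ} (f₀ : Fin n → Fin (n+1)) (D : Finset (Fin n))
    {σv : ℕ → Option ℕ} (hσ : Admissible (OmegaF n) σv) {prev : List AClause} {A : AClause}
    (h : IRStep (OmegaF n) ∅ σv prev A) (c : ℕ) (hc : 1 ≤ 2 * c)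
    (hp : ∀ B ∈ prev, (Missed f₀ D B).card ≤ c) : (Missed f₀ D A).card ≤ 2 * c := by
  classical
  cases h with
  | ax C hC hnt hnt' =>
    rw [applySigv_id hσ]
    obtain ⟨i₀, hi₀⟩ := matrix_sat n C hC
    refine le_trans (Finset.card_le_card (t := {i₀}) ?_) (by simpa using hc)
    intro i hi
    simp only [Missed, Finset.mem_filter, Finset.mem_univ, true_and] at hi
    obtain ⟨f, ⟨hf, _, hm⟩, β, hns⟩ := hi
    by_contra hne
    refine hns (ax_sat n C hC hnt f β (hi₀ f _ hf ?_))
    exact crit_surj hf hm (fun h => hne (by simp [h]))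
  | axExt C hC => simp at hC
  | res x τ A B hA hB hxa hxb =>
    have : Missed f₀ D ((A.erase ⟨Lit.pos x, τ⟩) ∪ (B.erase ⟨Lit.neg x, τ⟩)) ⊆
        Missed f₀ D A ∪ Missed f₀ D B := by
      intro i hi
      simp only [Missed, Finset.mem_filter, Finset.mem_univ, true_and, Finset.mem_union] at hi ⊢
      obtain ⟨f, hf, β, hns⟩ := hi
      by_cases hsA : Sat n f β A
      · exact Or.inr ⟨f, hf, β, fun hsB => hns (res_sat n A B x τ f β hsA hsB)⟩
      · exact Or.inl ⟨f, hf, β, hsA⟩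
    have h1 := Finset.card_le_card this
    have h2 := Finset.card_union_le (Missed f₀ D A) (Missed f₀ D B)
    have h3 := hp A hA
    have h4 := hp B hB
    omega
  | fac _ hA =>
    have := hp A hA
    omega
  | inst A τ hA hfun hdom =>
    refine le_trans (Finset.card_le_card (t := Missed f₀ D A) ?_) (by have := hp A hA; omega)
    intro i hi
    simp only [Missed, Finset.mem_filter, Finset.mem_univ, true_and] at hi ⊢
    obtain ⟨f, hf, β, hns⟩ := hi
    exact ⟨f, hf, compl n τ β, fun hs => hns (inst_sat n A τ f β hs)⟩

lemma missed_empty {n : ℕ} {f₀ : Fin n → Fin (n+1)} (hf₀ : Function.Injective f₀)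
    (D : Finset (Fin n)) : Missed f₀ D ∅ = FreeR f₀ D := by
  classical
  apply Finset.Subset.antisymm (missed_sub _ _ _)
  intro i hi
  simp only [Missed, Finset.mem_filter, Finset.mem_univ, true_and]
  have hns : ∃ i₀, ∀ j, f₀ j ≠ i₀ := by
    by_contra hcon
    push Not at hcon
    have := Fintype.card_le_of_surjective f₀ hcon
    simp at this
  obtain ⟨i₀, hi₀⟩ := hns
  refine ⟨fun j => Equiv.swap i₀ i (f₀ j), ⟨?_, ?_, ?_⟩, fun _ => false, ?_⟩
  · exact (Equiv.injective _).comp hf₀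
  · intro j hj
    exact Equiv.swap_apply_of_ne_of_ne (hi₀ j) (mem_FreeR.1 hi j hj)
  · intro j hj
    have : f₀ j = i₀ := by
      apply (Equiv.swap i₀ i).injective
      rw [Equiv.swap_apply_left]
      exact hj
    exact hi₀ j this
  · rintro ⟨al, hal, _⟩
    simp at hal

lemma exists_mid {n : ℕ} {f₀ : Fin n → Fin (n+1)} (hf₀ : Function.Injective f₀)
    (D : Finset (Fin n)) {σv : ℕ → Option ℕ} (hσ : Admissible (OmegaF n) σv)
    {π : List AClause} (hπ : IRRefutation (OmegaF n) ∅ σv π) (hM : 3 ≤ (FreeR f₀ D).card) :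
    ∃ A ∈ π, (FreeR f₀ D).card ≤ 3 * (Missed f₀ D A).card ∧
      3 * (Missed f₀ D A).card ≤ 2 * (FreeR f₀ D).card ∧ 0 < (Missed f₀ D A).card := by
  classical
  obtain ⟨hv, hne, hlast⟩ := hπ
  set M := (FreeR f₀ D).card with hMdef
  have hex : ∃ i, i < π.length ∧ M < 3 * (Missed f₀ D π[i]!).card := by
    have hlen : 0 < π.length := List.length_pos_of_ne_nil hne
    refine ⟨π.length - 1, by omega, ?_⟩
    have : π[π.length - 1]! = ∅ := by
      rw [← hlast, List.getLast!_eq_getLast?_getD, List.getLast?_eq_getElem?]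
      simp
    rw [this, missed_empty hf₀]
    omega
  obtain ⟨hi, hbig⟩ := Nat.find_spec hex
  have hmin := fun j => Nat.find_min hex (m := j)
  set i := Nat.find hex
  have hmem : π[i]! ∈ π := by
    rw [getElem!_pos π i hi]
    exact List.getElem_mem hi
  have hprev : ∀ B ∈ π.take i, 3 * (Missed f₀ D B).card ≤ M := by
    intro B hB
    obtain ⟨j, hj, rfl⟩ := List.mem_iff_getElem.1 hB
    have hj' : j < i := by
      rw [List.length_take] at hj
      omega
    have := hmin j hj'
    rw [getElem!_pos π j (by omega)] at this
    rw [List.getElem_take]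
    have h3 : j < π.length := by omega
    simp only [h3, true_and, not_lt] at this
    exact this
  refine ⟨π[i]!, hmem, hbig.le, ?_, by omega⟩
  have := step_missed f₀ D hσ (hv i hi) (M / 3) (by omega) (fun B hB => by
      have := hprev B hB
      omega)
  omega

/-! ## Greedy restriction -/

open Classical in
noncomputable def Big {n : ℕ} (π : List AClause) (f₀ : Fin n → Fin (n+1)) (D : Finset (Fin n)) :
    Finset AClause :=
  π.toFinset.filter fun A => (∀ j ∈ D, (f₀ j, j) ∉ Plus n A) ∧
    (n+1)^2 ≤ 18 * (Plus n A ∩ Free f₀ D).card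

lemma card_FreeR {n : ℕ} {f₀ : Fin n → Fin (n+1)} (hf₀ : Function.Injective f₀)
    (D : Finset (Fin n)) : (FreeR f₀ D).card = n + 1 - D.card := by
  rw [FreeR, Finset.card_sdiff_of_subset (Finset.subset_univ _),
    Finset.card_image_of_injective _ hf₀]
  simp

lemma greedy_step {n : ℕ} (π : List AClause) {f₀ : Fin n → Fin (n+1)}
    (hf₀ : Function.Injective f₀) (D : Finset (Fin n)) (hD : D.card < n) :
    ∃ f₁ : Fin n → Fin (n+1), Function.Injective f₁ ∧ ∃ D₁ : Finset (Fin n),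
      D₁.card = D.card + 1 ∧ 18 * (Big π f₁ D₁).card ≤ 17 * (Big π f₀ D).card := by
  classical
  have hR := card_FreeR hf₀ D
  have hC : (Finset.univ \ D : Finset (Fin n)).card = n - D.card := by
    rw [Finset.card_sdiff_of_subset (Finset.subset_univ _)]
    simp
  have hFne : (Free f₀ D).Nonempty := by
    rw [← Finset.card_pos, Free, Finset.card_product, hR, hC]
    exact Nat.mul_pos (by omega) (by omega)
  have hFle : (Free f₀ D).card ≤ (n+1)^2 := by
    rw [Free, Finset.card_product, hR, hC, sq]
    exact Nat.mul_le_mul (by omega) (by omega)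
  set L := Big π f₀ D with hL
  have hcount : ∑ p ∈ Free f₀ D, (L.filter fun A => p ∈ Plus n A).card =
      ∑ A ∈ L, (Plus n A ∩ Free f₀ D).card := by
    simp only [Finset.card_filter]
    rw [Finset.sum_comm]
    refine Finset.sum_congr rfl fun A _ => ?_
    rw [← Finset.card_filter, Finset.inter_comm, Finset.filter_mem_eq_inter]
  have hge : L.card * (n+1)^2 ≤ 18 * ∑ A ∈ L, (Plus n A ∩ Free f₀ D).card := by
    rw [Finset.mul_sum, ← smul_eq_mul]
    apply Finset.card_nsmul_le_sum
    intro A hA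
    exact (Finset.mem_filter.1 hA).2.2
  have hex : ∃ p ∈ Free f₀ D, L.card ≤ 18 * (L.filter fun A => p ∈ Plus n A).card := by
    by_contra hcon
    push Not at hcon
    have h1 := Finset.sum_lt_sum_of_nonempty hFne hcon
    rw [← Finset.mul_sum, hcount, Finset.sum_const, smul_eq_mul] at h1
    have h2 := Nat.mul_le_mul_right L.card hFle
    rw [mul_comm] at hge
    omega
  obtain ⟨⟨a, b⟩, hp, hpc⟩ := hex
  simp only [Free, Finset.mem_product, Finset.mem_sdiff, Finset.mem_univ, true_and] at hp
  obtain ⟨ha, hb⟩ := hp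
  have hagree : ∀ j ∈ D, Equiv.swap a (f₀ b) (f₀ j) = f₀ j := by
    intro j hj
    refine Equiv.swap_apply_of_ne_of_ne (mem_FreeR.1 ha j hj) fun h => hb ?_
    exact hf₀ h ▸ hj
  refine ⟨fun j => Equiv.swap a (f₀ b) (f₀ j), (Equiv.injective _).comp hf₀, insert b D,
    Finset.card_insert_of_notMem hb, ?_⟩
  have hsub : Big π (fun j => Equiv.swap a (f₀ b) (f₀ j)) (insert b D) ⊆
      L.filter fun A => ¬ (a, b) ∈ Plus n A := by
    intro A hA
    obtain ⟨hAπ, h1, h2⟩ := Finset.mem_filter.1 hA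
    refine Finset.mem_filter.2 ⟨Finset.mem_filter.2 ⟨hAπ, ?_, ?_⟩, ?_⟩
    · intro j hj
      have := h1 j (Finset.mem_insert_of_mem hj)
      simpa only [hagree j hj] using this
    · refine h2.trans (Nat.mul_le_mul_left _ (Finset.card_le_card ?_))
      refine Finset.inter_subset_inter_left (Finset.product_subset_product ?_ ?_)
      · intro i hi
        rw [mem_FreeR] at hi ⊢
        intro j hj
        have := hi j (Finset.mem_insert_of_mem hj)
        simpa only [hagree j hj] using this
      · exact Finset.sdiff_subset_sdiff le_rfl (Finset.subset_insert _ _)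
    · have := h1 b (Finset.mem_insert_self _ _)
      simpa only [Equiv.swap_apply_right] using this
  have h1 := Finset.card_le_card hsub
  have h2 := Finset.card_filter_add_card_filter_not (s := L) (fun A => (a, b) ∈ Plus n A)
  omega

lemma greedy {n : ℕ} (π : List AClause) (t : ℕ) (ht : t ≤ n) :
    ∃ f₀ : Fin n → Fin (n+1), Function.Injective f₀ ∧ ∃ D : Finset (Fin n), D.card = t ∧
      18 ^ t * (Big π f₀ D).card ≤ 17 ^ t * (Big π (Fin.castSucc : Fin n → Fin (n+1)) ∅).card := by
  induction t with
  | zero => exact ⟨Fin.castSucc, Fin.castSucc_injective n, ∅, rfl, by simp⟩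
  | succ t ih =>
    obtain ⟨f₀, hf₀, D, hD, h⟩ := ih (by omega)
    obtain ⟨f₁, hf₁, D₁, hD₁, h₁⟩ := greedy_step π hf₀ D (by omega)
    refine ⟨f₁, hf₁, D₁, by omega, ?_⟩
    calc 18 ^ (t+1) * (Big π f₁ D₁).card = 18 ^ t * (18 * (Big π f₁ D₁).card) := by ring
      _ ≤ 18 ^ t * (17 * (Big π f₀ D).card) := Nat.mul_le_mul_left _ h₁
      _ = 17 * (18 ^ t * (Big π f₀ D).card) := by ring
      _ ≤ 17 * (17 ^ t * (Big π (Fin.castSucc : Fin n → Fin (n+1)) ∅).card) :=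
        Nat.mul_le_mul_left _ h
      _ = _ := by ring

lemma length_filter_le (π : List AClause) :
    (π.filter fun A => decide (0 < AClause.symSize A)).length ≤ aSize π := by
  induction π with
  | nil => simp [aSize]
  | cons A π ih =>
    simp only [aSize, List.map_cons, List.sum_cons] at ih ⊢
    by_cases h : 0 < AClause.symSize A
    · rw [List.filter_cons_of_pos (by simpa using h), List.length_cons]
      omega
    · rw [List.filter_cons_of_neg (by simpa using h)]
      omega

lemma big_le {n : ℕ} (π : List AClause) (f₀ : Fin n → Fin (n+1)) (D : Finset (Fin n)) :
    (Big π f₀ D).card ≤ aSize π := by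
  classical
  refine le_trans ?_ (length_filter_le π)
  refine le_trans (Finset.card_le_card ?_) (List.toFinset_card_le _)
  intro A hA
  obtain ⟨hAπ, _, h2⟩ := Finset.mem_filter.1 hA
  simp only [List.mem_toFinset, List.mem_filter, decide_eq_true_eq] at hAπ ⊢
  refine ⟨hAπ, ?_⟩
  have hne : A.Nonempty := by
    rw [Finset.nonempty_iff_ne_empty]
    rintro rfl
    simp [Plus] at h2
  exact Finset.sum_pos (fun al _ => by simp [ALit.symSize]) hne

lemma main_bound {n : ℕ} (hn : 4 ≤ n) {σv : ℕ → Option ℕ} (hσ : Admissible (OmegaF n) σv)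
    {π : List AClause} (hπ : IRRefutation (OmegaF n) ∅ σv π) :
    18 ^ (n / 2) ≤ 17 ^ (n / 2) * aSize π := by
  classical
  obtain ⟨f₀, hf₀, D, hD, h⟩ := greedy (n := n) π (n / 2) (by omega)
  have hM := card_FreeR hf₀ D
  obtain ⟨A, hAπ, h1, h2, h3⟩ := exists_mid hf₀ D hσ hπ (by omega)
  have hw := wide (by omega) f₀ D A
  have hA : A ∈ Big π f₀ D := by
    refine Finset.mem_filter.2 ⟨by simpa using hAπ, ?_, ?_⟩
    · obtain ⟨i, hi⟩ := Finset.card_pos.1 h3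
      simp only [Missed, Finset.mem_filter, Finset.mem_univ, true_and] at hi
      obtain ⟨f, ⟨_, hfD, _⟩, β, hns⟩ := hi
      intro j hj
      rw [← hfD j hj]
      exact not_sat_plus hns j
    · refine le_trans ?_ (Nat.mul_le_mul_left 18 hw)
      have hM2 : n + 1 ≤ 2 * (FreeR f₀ D).card := by omega
      generalize (FreeR f₀ D).card = M at *
      generalize (Missed f₀ D A).card = s at *
      obtain ⟨d, rfl⟩ : ∃ d, M = s + d := ⟨M - s, by omega⟩
      rw [Nat.add_sub_cancel_left]
      have e1 : d ≤ 2 * s := by omega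
      have e2 : s ≤ 2 * d := by omega
      have e3 : (n+1)^2 ≤ (2 * (s+d))^2 := Nat.pow_le_pow_left hM2 2
      zify at *
      nlinarith [mul_nonneg (sub_nonneg.2 e1) (sub_nonneg.2 e2)]
  have hpos : 1 ≤ (Big π f₀ D).card := Finset.card_pos.2 ⟨A, hA⟩
  calc 18 ^ (n / 2) ≤ 18 ^ (n / 2) * (Big π f₀ D).card := Nat.le_mul_of_pos_right _ hpos
    _ ≤ _ := h
    _ ≤ _ := Nat.mul_le_mul_left _ (big_le _ _ _)

open Filter Asymptotics in
lemma poly_littleO (q : Polynomial ℕ) :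
    (fun n : ℕ => ((q.eval n : ℕ) : ℝ)) =o[atTop] fun n : ℕ => (101/100 : ℝ) ^ n := by
  induction q using Polynomial.induction_on' with
  | add p q hp hq => simpa using hp.add hq
  | monomial k a =>
    have := (isLittleO_pow_const_const_pow_of_one_lt (R := ℝ) k
      (show (1:ℝ) < 101/100 by norm_num)).const_mul_left (a : ℝ)
    simpa using this

end OmegaLB

/-- for every admissible substitution σ_v, every refutation
of Ω_n in IR-calc^{σ_v} has size superpolynomial in n. -/
theorem ircalc_subst_superpolynomial_on_Omega :
    ∀ q : Polynomial ℕ, ∃ N : ℕ, ∀ n : ℕ, N ≤ n →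
      ∀ σv : ℕ → Option ℕ, Admissible (OmegaF n) σv →
        ∀ π : List AClause, IRRefutation (OmegaF n) ∅ σv π →
          q.eval n < aSize π := by
  intro q
  have h := (OmegaLB.poly_littleO q).def (show (0:ℝ) < 1/2 by norm_num)
  obtain ⟨N, hN⟩ := Filter.eventually_atTop.1 h
  refine ⟨max N 4, fun n hn σv hσ π hπ => ?_⟩
  have h1 := hN n (le_trans (le_max_left _ _) hn)
  have h2 := OmegaLB.main_bound (le_trans (le_max_right _ _) hn) hσ hπ
  have h3 : (18 : ℝ) ^ (n / 2) ≤ 17 ^ (n / 2) * (aSize π : ℝ) := by exact_mod_cast h2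
  have h4 : ((18 : ℝ) / 17) ^ (n / 2) ≤ aSize π := by
    rw [div_pow, div_le_iff₀ (by positivity), mul_comm]
    exact h3
  have h5 : (101/100 : ℝ) ^ n ≤ 101/100 * (18/17 : ℝ) ^ (n/2) := by
    calc (101/100 : ℝ) ^ n ≤ (101/100 : ℝ) ^ (2 * (n/2) + 1) :=
          pow_le_pow_right₀ (by norm_num) (by omega)
      _ = 101/100 * ((101/100 : ℝ)^2) ^ (n/2) := by rw [pow_succ, pow_mul]; ring
      _ ≤ _ := by
        gcongr
        norm_num
  have h6 : (0:ℝ) < (18/17) ^ (n/2) := by positivity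
  rw [Real.norm_of_nonneg (by positivity), Real.norm_of_nonneg (by positivity)] at h1
  have h7 : ((q.eval n : ℕ) : ℝ) < (aSize π : ℝ) := by linarith
  exact_mod_cast h7
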